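/- Let R^1 be the profile ≽_1: {a,c},{b,d}; ≽_2: {b,d},{a,c}; ≽_3: {a,d},b,c; ≽_4: {b,c},a,d. Then f(R^1) = 1/2 a + 1/2 b. -/

import Mathlib

open Finset
open scoped Classical

section Framework

variable {A : Type*} [Fintype A] {n : ℕ}

/-- `p` is a lottery (probability distribution) on the set of alternatives `A`. -/
def IsLottery (p : A → ℝ) : Prop := (∀ x, 0 ≤ p x) ∧ ∑ x, p x = 1

/-- `r` is a weak preference relation: complete (total) and transitive. -/
def IsPref (r : A → A → Prop) : Prop := Total r ∧ Transitive r

/-- A preference profile assigns a weak preference relation to each of the `n` agents. -/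
def IsProfile (R : Fin n → A → A → Prop) : Prop := ∀ i, IsPref (R i)

/-- The probability that `p` assigns to alternatives weakly preferred (by `r`) to `x`. -/
noncomputable def upperProb (r : A → A → Prop) (p : A → ℝ) (x : A) : ℝ :=
  ∑ y ∈ univ.filter (fun y => r y x), p y

/-- Stochastic dominance: `p ≽^sd q` w.r.t. the preference relation `r`. -/
def SDge (r : A → A → Prop) (p q : A → ℝ) : Prop :=
  ∀ x, upperProb r q x ≤ upperProb r p x

/-- Strict stochastic dominance: `p ≻^sd q` w.r.t. the preference relation `r`. -/
def SDgt (r : A → A → Prop) (p q : A → ℝ) : Prop :=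
  SDge r p q ∧ ¬ SDge r q p

/-- A social decision scheme maps every preference profile to a lottery. -/
def IsSDS (f : (Fin n → A → A → Prop) → (A → ℝ)) : Prop :=
  ∀ R : Fin n → A → A → Prop, IsProfile R → IsLottery (f R)

/-- Anonymity: invariance under permutations of the agents. -/
def Anonymous (f : (Fin n → A → A → Prop) → (A → ℝ)) : Prop :=
  ∀ R : Fin n → A → A → Prop, IsProfile R → ∀ π : Equiv.Perm (Fin n),
    f (fun i => R (π i)) = f R

/-- Neutrality: `f(R^σ)(σ x) = f(R)(x)`, where `R^σ` relabels alternatives by `σ`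
(i.e. `σ x ≽^σ_i σ y ↔ x ≽_i y`). -/
def Neutral (f : (Fin n → A → A → Prop) → (A → ℝ)) : Prop :=
  ∀ R : Fin n → A → A → Prop, IsProfile R → ∀ σ : Equiv.Perm A, ∀ x : A,
    f (fun i u v => R i (σ.symm u) (σ.symm v)) (σ x) = f R x

/-- The lottery `p` is sd-efficient for the profile `R`: no lottery `q` is weakly
sd-preferred to `p` by all agents and strictly sd-preferred by some agent. -/
def SDEfficientLottery (R : Fin n → A → A → Prop) (p : A → ℝ) : Prop :=
  ¬ ∃ q : A → ℝ, IsLottery q ∧ (∀ i, SDge (R i) q p) ∧ (∃ i, SDgt (R i) q p)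

/-- sd-efficiency of a social decision scheme. -/
def SDEfficient (f : (Fin n → A → A → Prop) → (A → ℝ)) : Prop :=
  ∀ R : Fin n → A → A → Prop, IsProfile R → SDEfficientLottery R (f R)

/-- sd-strategyproofness: no agent can misreport and obtain a strictly
sd-preferred lottery. -/
def SDStrategyproof (f : (Fin n → A → A → Prop) → (A → ℝ)) : Prop :=
  ∀ R R' : Fin n → A → A → Prop, IsProfile R → IsProfile R' → ∀ i : Fin n,
    (∀ j, j ≠ i → R j = R' j) → ¬ SDgt (R i) (f R') (f R)

/-- `x` is the unique most-preferred alternative of the relation `r`. -/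
def UniqueTop (r : A → A → Prop) (x : A) : Prop :=
  ∀ y, y ≠ x → r x y ∧ ¬ r y x

/-- `f` extends random dictatorship: whenever every agent has a unique top choice,
each alternative gets probability (number of agents having it as top)/n. -/
def ExtendsRD (f : (Fin n → A → A → Prop) → (A → ℝ)) : Prop :=
  ∀ R : Fin n → A → A → Prop, IsProfile R →
    ∀ t : Fin n → A, (∀ i, UniqueTop (R i) (t i)) →
      ∀ x : A, f R x = ((univ.filter (fun i => t i = x)).card : ℝ) / (n : ℝ)

/-- `x` is Pareto-dominated in the profile `R`. -/
def Pareto_Dominated (R : Fin n → A → A → Prop) (x : A) : Prop :=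
  ∃ y : A, (∀ i, R i y x) ∧ ∃ i, R i y x ∧ ¬ R i x y

end Framework

/-! Concrete setting: alternatives `A = {a,b,c,d}` encoded as `Fin 4`. -/

/-- The alternative `a`. -/ def a : Fin 4 := 0
/-- The alternative `b`. -/ def b : Fin 4 := 1
/-- The alternative `c`. -/ def c : Fin 4 := 2
/-- The alternative `d`. -/ def d : Fin 4 := 3

/-- The weak preference relation induced by a rank function over `(a,b,c,d)`
(lower rank = more preferred; equal ranks = indifference). -/
def pr (rk : Fin 4 → ℕ) : Fin 4 → Fin 4 → Prop := fun x y => rk x ≤ rk y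


/-- The profile `R1`: ≽₁: {a,c},{b,d}; ≽₂: {b,d},{a,c}; ≽₃: {a,d},b,c; ≽₄: {b,c},a,d. -/
def R1 : Fin 4 → Fin 4 → Fin 4 → Prop :=
  ![pr ![0,1,0,1], pr ![1,0,1,0], pr ![0,1,2,0], pr ![1,0,0,2]]

/-- A relation induced by a rank function is a weak preference relation. -/
lemma isPref_pr (rk : Fin 4 → ℕ) : IsPref (pr rk) := by
  refine ⟨?_, ?_⟩
  · intro x y
    exact le_total (rk x) (rk y)
  · intro x y z hxy hyz
    exact le_trans hxy hyz

/-- The rank functions defining `R1`. -/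
def rankR1 : Fin 4 → Fin 4 → ℕ :=
  ![![0,1,0,1], ![1,0,1,0], ![0,1,2,0], ![1,0,0,2]]

lemma R1_eq_pr (i : Fin 4) : R1 i = pr (rankR1 i) := by
  fin_cases i <;> rfl

lemma isProfile_R1 : IsProfile R1 := fun i => R1_eq_pr i ▸ isPref_pr _

/-- The involution of `Fin 4` exchanging `0` with `1` and `2` with `3`. -/
def pairSwap : Equiv.Perm (Fin 4) where
  toFun := ![1, 0, 3, 2]
  invFun := ![1, 0, 3, 2]
  left_inv := by decide
  right_inv := by decide

/-- Swapping the agents in pairs has the same effect on `R1` as swapping the alternatives. -/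
lemma R1_comp_pairSwap :
    (fun i => R1 (pairSwap i)) =
      fun i u v => R1 i (pairSwap.symm u) (pairSwap.symm v) := by
  have hrank : ∀ i u, rankR1 (pairSwap i) u = rankR1 i (pairSwap.symm u) := by decide
  funext i u v
  simp only [R1_eq_pr, pr, hrank]

lemma apply_pairSwap_R1 {f : (Fin 4 → Fin 4 → Fin 4 → Prop) → (Fin 4 → ℝ)}
    (han : Anonymous f) (hneu : Neutral f) (x : Fin 4) :
    f R1 (pairSwap x) = f R1 x := by
  rw [← hneu R1 isProfile_R1 pairSwap x, ← R1_comp_pairSwap, han R1 isProfile_R1]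

/-- `upperProb` as a sum over all alternatives, for relations induced by a rank function. -/
lemma upperProb_pr (rk : Fin 4 → ℕ) (p : Fin 4 → ℝ) (x : Fin 4) :
    upperProb (pr rk) p x = ∑ y, if rk y ≤ rk x then p y else 0 := by
  rw [upperProb, Finset.sum_filter]
  exact Finset.sum_congr rfl fun y _ => if_congr Iff.rfl rfl rfl

/-- Symmetric lotteries giving positive probability to `c` and `d` are inefficient in `R1`. -/
lemma eq_zero_of_sdEfficientLottery_R1 {p : Fin 4 → ℝ} (hp : IsLottery p)
    (hab : p 1 = p 0) (hcd : p 3 = p 2) (heff : SDEfficientLottery R1 p) : p 2 = 0 := by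
  obtain ⟨hnonneg, hsum⟩ := hp
  rw [Fin.sum_univ_four] at hsum
  have hc := hnonneg 2
  by_contra hne
  have hpos : 0 < p 2 := lt_of_le_of_ne hc (Ne.symm hne)
  have hge : ∀ i, SDge (R1 i) ![1/2, 1/2, 0, 0] p := by
    intro i x
    rw [R1_eq_pr, upperProb_pr, upperProb_pr]
    fin_cases i <;> fin_cases x <;> simp [Fin.sum_univ_four, rankR1] <;> linarith
  refine heff ⟨![1/2, 1/2, 0, 0], ⟨?_, ?_⟩, hge, 2, hge 2, ?_⟩
  · intro x
    fin_cases x <;> simp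
  · simp [Fin.sum_univ_four]
    norm_num
  · intro h
    have hb := h 1
    rw [R1_eq_pr, upperProb_pr, upperProb_pr] at hb
    simp [Fin.sum_univ_four, rankR1] at hb
    linarith

theorem stmt3 (f : (Fin 4 → Fin 4 → Fin 4 → Prop) → (Fin 4 → ℝ))
    (hf : IsSDS f) (han : Anonymous f) (hneu : Neutral f)
    (heff : SDEfficient f) (hsp : SDStrategyproof f) :
    f R1 = ![1/2, 1/2, 0, 0] := by
  have hp := hf R1 isProfile_R1
  have hab : f R1 1 = f R1 0 := apply_pairSwap_R1 han hneu 0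
  have hcd : f R1 3 = f R1 2 := apply_pairSwap_R1 han hneu 2
  have hc := eq_zero_of_sdEfficientLottery_R1 hp hab hcd (heff R1 isProfile_R1)
  have hsum := hp.2
  rw [Fin.sum_univ_four] at hsum
  funext x
  fin_cases x <;> simp <;> linarith
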